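/- Fix y = (y₁,y₂) ∈ ℝ² with y₂ > 0 and f = (f₁,f₂) ∈ ℝ². Define uᵂᵢ(x) = Σⱼ Sᵢⱼ(x,y) fⱼ − Σⱼ Sᵢⱼ(x,yᴵ) fᴵⱼ − [x₂ ∂φ/∂xᵢ(x) − δᵢ₂ φ(x)], where φ(x) = fᴵ₂ Gˢ(x,yᴵ) + y₂ Gᴰ[fᴵ](x,yᴵ). Then uᵂ satisfies the no-slip condition: uᵂᵢ(x) = 0 for i = 1,2 and every x = (x₁,0) with x ≠ yᴵ. -/

import Mathlib

open Real Finset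

noncomputable section

/-- Points in two-dimensional Euclidean space. -/
abbrev E2 := EuclideanSpace ℝ (Fin 2)

/-- Partial derivative `∂f/∂xᵢ` of a scalar field on `ℝ²`. -/
def pd (i : Fin 2) (f : E2 → ℝ) (x : E2) : ℝ :=
  fderiv ℝ f x (EuclideanSpace.single i 1)

/-- Kronecker delta. -/
def kron (i j : Fin 2) : ℝ := if i = j then 1 else 0

/-- Reflected image point `yᴵ = (y₁, -y₂)`. -/
def reflPt (y : E2) : E2 := (EuclideanSpace.equiv (Fin 2) ℝ).symm ![y 0, -y 1]

/-- Reflected vector `fᴵ = (f₁, -f₂)`. -/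
def reflVec (f : Fin 2 → ℝ) : Fin 2 → ℝ := ![f 0, -f 1]

/-- Two-dimensional free-space Laplace Green's function `Gˢ(x,y) = -(1/2π) log|x-y|`. -/
def GS (x y : E2) : ℝ := -(1 / (2 * π)) * Real.log ‖x - y‖

/-- Two-dimensional dipole potential `Gᴰ[ν](x,y) = Σᵢ νᵢ ∂/∂yᵢ Gˢ(x,y)`. -/
def GD (ν : Fin 2 → ℝ) (x y : E2) : ℝ := ∑ i, ν i * pd i (fun z => GS x z) y

/-- Two-dimensional quadrupole potential
`G^Q[ν,κ](x,y) = Σᵢ Σⱼ νᵢ κⱼ ∂²/∂yᵢ∂yⱼ Gˢ(x,y)`. -/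
def GQ (ν κ : Fin 2 → ℝ) (x y : E2) : ℝ :=
  ∑ i, ∑ j, ν i * κ j * pd i (fun z => pd j (fun w => GS x w) z) y

/-- The two-dimensional Stokeslet
`Sᵢⱼ(x,y) = (1/4π)[-δᵢⱼ log|x-y| + (xᵢ-yᵢ)(xⱼ-yⱼ)/|x-y|²]`. -/
def stokeslet2 (x y : E2) (i j : Fin 2) : ℝ :=
  (1 / (4 * π)) * (-(kron i j) * Real.log ‖x - y‖ + (x i - y i) * (x j - y j) / ‖x - y‖ ^ 2)

/-- The two-dimensional Papkovich–Neuber potential for the Stokeslet image system: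
`φ(x) = fᴵ₂ Gˢ(x,yᴵ) + y₂ Gᴰ[fᴵ](x,yᴵ)`. -/
def phiS2 (y : E2) (f : Fin 2 → ℝ) (x : E2) : ℝ :=
  reflVec f 1 * GS x (reflPt y) + y 1 * GD (reflVec f) x (reflPt y)

/-- The half-plane Stokeslet velocity `uᵂ`. -/
def uW2 (y : E2) (f : Fin 2 → ℝ) (i : Fin 2) (x : E2) : ℝ :=
  (∑ j, stokeslet2 x y i j * f j) - (∑ j, stokeslet2 x (reflPt y) i j * reflVec f j)
    - (x 1 * pd i (phiS2 y f) x - if i = 1 then phiS2 y f x else 0)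

/-- The gradient of `Gˢ(x, ·)` away from the singularity. -/
theorem pd_GS {x y : E2} (hxy : x ≠ y) (i : Fin 2) :
    pd i (fun z => GS x z) y = 1 / (2 * π) * ((x i - y i) / ‖x - y‖ ^ 2) := by
  have hne : ‖x - y‖ ^ 2 ≠ 0 := pow_ne_zero 2 (norm_ne_zero_iff.mpr (sub_ne_zero.mpr hxy))
  have hsq : (fun z => GS x z) = fun z => -(1 / (4 * π)) * Real.log (‖x - z‖ ^ 2) := by
    funext z
    rw [GS, Real.log_pow]
    push_cast
    ring
  have hd := ((((hasFDerivAt_id y).const_sub x).norm_sq).log hne).const_mul (-(1 / (4 * π)))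
  rw [pd, hsq]
  simp only [id] at hd
  rw [hd.fderiv]
  simp [EuclideanSpace.inner_single_right]
  ring

theorem GD_eq (ν : Fin 2 → ℝ) {x y : E2} (hxy : x ≠ y) :
    GD ν x y = 1 / (2 * π) * ((ν 0 * (x 0 - y 0) + ν 1 * (x 1 - y 1)) / ‖x - y‖ ^ 2) := by
  rw [GD, Fin.sum_univ_two, pd_GS hxy, pd_GS hxy]
  ring

/-- A point of the wall is equidistant from a source and its image. -/
theorem norm_sub_reflPt {x : E2} (hx : x 1 = 0) (y : E2) : ‖x - reflPt y‖ = ‖x - y‖ := by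
  simp [EuclideanSpace.norm_eq, Fin.sum_univ_two, reflPt, hx]

/-- the half-plane Stokeslet `uᵂ` satisfies the no-slip condition
on the line `x₂ = 0`. -/
theorem stokeslet_halfplane_no_slip (y : E2) (hy : 0 < y 1) (f : Fin 2 → ℝ) :
    ∀ x : E2, x 1 = 0 → x ≠ reflPt y → ∀ i, uW2 y f i x = 0 := by
  intro x hx hxy i
  have h0 : reflPt y 0 = y 0 := rfl
  have h1 : reflPt y 1 = -y 1 := rfl
  fin_cases i <;>
    simp [uW2, phiS2, GD_eq _ hxy, GS, stokeslet2, kron, reflVec, Fin.sum_univ_two,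
      norm_sub_reflPt hx, hx, h0, h1] <;>
    ring
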